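/- Let E be a real inner product space, let θ ∈ E, let L₂ : E → ℝ be differentiable at θ with gradient ∇L₂(θ), let P be a finite nonempty set, and let g : P → E. Suppose p* ∈ P strictly maximizes the inner product, i.e. ⟨g(p*), ∇L₂(θ)⟩ > ⟨g(p), ∇L₂(θ)⟩ for every p ≠ p*. Then there exists η₀ > 0 such that for every learning rate η with 0 < η < η₀ and every p ≠ p*, one has L₂(θ − η·g(p*)) < L₂(θ − η·g(p)); that is, p* is the unique minimizer of p ↦ L₂(θ − η·g(p)). -/

import Mathlib

open scoped RealInnerProductSpace

/-- The derivative at `0` of a function along the ray `η ↦ θ - η • v`. -/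
theorem HasGradientAt.hasDerivAt_sub_smul
    {E : Type*} [NormedAddCommGroup E] [InnerProductSpace ℝ E] [CompleteSpace E]
    {θ : E} {f : E → ℝ} {f' : E} (hf : HasGradientAt f f' θ) (v : E) :
    HasDerivAt (fun η : ℝ => f (θ - η • v)) (-⟪v, f'⟫) 0 := by
  have hline : HasDerivAt (fun η : ℝ => θ - η • v) (-v) 0 := by
    simpa using ((hasDerivAt_id (0 : ℝ)).smul_const v).const_sub θ
  have hf' : HasFDerivAt f (InnerProductSpace.toDual ℝ E f') (θ - (0 : ℝ) • v) := by
    simpa using hf.hasFDerivAt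
  simpa [Function.comp_def, real_inner_comm] using hf'.comp_hasDerivAt (0 : ℝ) hline

/-- A function with a positive derivative at `a` exceeds its value at `a` just to the right. -/
theorem HasDerivAt.eventually_nhdsGT_lt {f : ℝ → ℝ} {f' a : ℝ}
    (hf : HasDerivAt f f' a) (hf' : 0 < f') : ∀ᶠ x in nhdsWithin a (Set.Ioi a), f a < f x := by
  have hslope := (hasDerivAt_iff_tendsto_slope.1 hf).mono_left
    (nhdsWithin_mono a fun _ hx => ne_of_gt hx)
  filter_upwards [hslope.eventually_const_lt hf', self_mem_nhdsWithin] with x hx hax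
  rw [slope_def_field, div_pos_iff_of_pos_right (sub_pos.2 hax)] at hx
  exact sub_pos.1 hx

/-- If `p*` strictly maximizes the gradient inner product `⟪g p, ∇L₂(θ)⟫` over a finite
nonempty index set `P`, then for all sufficiently small learning rates `η > 0`, `p*` is the
unique minimizer of the outer loss after a one-step update `θ - η • g p`. -/
theorem strict_inner_maximizer_is_unique_one_step_minimizer
    {E : Type*} [NormedAddCommGroup E] [InnerProductSpace ℝ E] [CompleteSpace E]
    (θ : E) (L₂ : E → ℝ) (gradL : E) (hL : HasGradientAt L₂ gradL θ)
    {P : Type*} [Fintype P] [Nonempty P] (g : P → E) (pstar : P)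
    (hmax : ∀ p : P, p ≠ pstar → ⟪g p, gradL⟫ < ⟪g pstar, gradL⟫) :
    ∃ η₀ > (0 : ℝ), ∀ η : ℝ, 0 < η → η < η₀ → ∀ p : P, p ≠ pstar →
      L₂ (θ - η • g pstar) < L₂ (θ - η • g p) := by
  have hev : ∀ᶠ η in nhdsWithin (0 : ℝ) (Set.Ioi 0), ∀ p : P, p ≠ pstar →
      L₂ (θ - η • g pstar) < L₂ (θ - η • g p) := by
    refine Filter.eventually_all.2 fun p => ?_
    by_cases hp : p = pstar
    · simp [hp]
    have hdiff := (hL.hasDerivAt_sub_smul (g p)).sub (hL.hasDerivAt_sub_smul (g pstar))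
    filter_upwards [hdiff.eventually_nhdsGT_lt (by linarith [hmax p hp])] with η hη _
    simpa using hη
  obtain ⟨η₀, hη₀, hsub⟩ := mem_nhdsGT_iff_exists_Ioo_subset.1 hev
  exact ⟨η₀, hη₀, fun η hpos hlt => hsub ⟨hpos, hlt⟩⟩
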